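/- arXiv:2004.04939 — 2 statements merged into one kernel-verified Lean document; each statement's English description precedes it below -/
import Mathlib

section
/- For each i ∈ I there exists a unique F-algebra endomorphism T_i of K_t(A) such that for all j ∈ I and m ∈ ℤ: T_i(y(j,m)) = y(j, m + δ_{ij}) if a(i,j) ≠ −1, and T_i(y(j,m)) = (t^{1/2} y(j,m) y(i,m) − t^{−1/2} y(i,m) y(j,m)) / (t − t^{−1}) if a(i,j) = −1. (In particular these assignments respect all the defining relations (a), (b), (c).) -/
noncomputable section

/-- The base field `F = ℂ(s)`, rational functions over `ℂ` in one variable `s`. -/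
abbrev F : Type := RatFunc ℂ

/-- `t^{1/2} := s`. -/
def tHalf : F := RatFunc.X

/-- `t := s^2`. -/
def tq : F := RatFunc.X ^ 2

/-- `A = (a i j)` is the Cartan matrix of a finite-dimensional simply-laced simple Lie
algebra of type ADE: a symmetric positive-definite integer matrix with diagonal entries `2`
and off-diagonal entries in `{0, -1}`. -/
def IsCartanADE {I : Type} [Fintype I] (a : I → I → ℤ) : Prop :=
  (∀ i, a i i = 2) ∧ (∀ i j, a i j = a j i) ∧
    (∀ i j, i ≠ j → a i j = 0 ∨ a i j = -1) ∧
    Matrix.PosDef (Matrix.of fun i j : I => (a i j : ℝ))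

variable {I : Type} [Fintype I] [DecidableEq I]

/-- The generator `y(i,m)` of the free algebra. -/
def X (i : I) (m : ℤ) : FreeAlgebra F (I × ℤ) := FreeAlgebra.ι F (i, m)

/-- The defining relations (a), (b), (c) of the quantum Grothendieck ring `K_t(A)`:
(a) quantum Serre relations in each copy, (b) `t`-boson relations between adjacent
copies, (c) `t`-commutation relations between non-adjacent copies. -/
inductive KtRel (a : I → I → ℤ) :
    FreeAlgebra F (I × ℤ) → FreeAlgebra F (I × ℤ) → Prop
  | comm0 {i j : I} {m : ℤ} (h : a i j = 0) :
      KtRel a (X i m * X j m) (X j m * X i m)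
  | serre {i j : I} {m : ℤ} (h : a i j = -1) :
      KtRel a (X i m ^ 2 * X j m + X j m * X i m ^ 2)
        ((tq + tq⁻¹) • (X i m * X j m * X i m))
  | boson (i j : I) (m : ℤ) :
      KtRel a (X i m * X j (m + 1))
        ((tq ^ (a i j)) • (X j (m + 1) * X i m)
          + (if i = j then ((1 : F) - tq ^ 2) • (1 : FreeAlgebra F (I × ℤ)) else 0))
  | tcomm {i j : I} {m p : ℤ} (h : p > m + 1) :
      KtRel a (X i m * X j p)
        ((tq ^ ((((-1 : ℤˣ) ^ (p - m + 1) : ℤˣ) : ℤ) * a i j)) • (X j p * X i m))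

/-- The quantum Grothendieck ring `K_t(A)`. -/
abbrev Kt (a : I → I → ℤ) := RingQuot (KtRel a)

/-- The generators `y(i,m)` of `K_t(A)`. -/
def y (a : I → I → ℤ) (i : I) (m : ℤ) : Kt a :=
  RingQuot.mkAlgHom F (KtRel a) (X i m)

/-- `z(i; j, m) := (t^{1/2} y(j,m) y(i,m) − t^{−1/2} y(i,m) y(j,m)) / (t − t^{−1})`. -/
def z (a : I → I → ℤ) (i j : I) (m : ℤ) : Kt a :=
  (tq - tq⁻¹)⁻¹ • (tHalf • (y a j m * y a i m) - tHalf⁻¹ • (y a i m * y a j m))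

/-- `T` satisfies the defining formulas of the braid-group generator `T_i` on `K_t(A)`:
`T(y(j,m)) = y(j, m + δ_{ij})` if `a i j ≠ -1`, and
`T(y(j,m)) = (t^{1/2} y(j,m) y(i,m) − t^{−1/2} y(i,m) y(j,m)) / (t − t^{−1})`
if `a i j = -1`. -/
def TiFormula (a : I → I → ℤ) (i : I) (T : Kt a → Kt a) : Prop :=
  ∀ (j : I) (m : ℤ),
    T (y a j m) =
      if a i j = -1 then z a i j m else y a j (m + if i = j then 1 else 0)

/-- `T` satisfies the defining formulas of the inverse braid-group generator `T_i'`: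
`T(y(j,m)) = y(j, m − δ_{ij})` if `a i j ≠ -1`, and
`T(y(j,m)) = (t^{1/2} y(i,m) y(j,m) − t^{−1/2} y(j,m) y(i,m)) / (t − t^{−1})`
if `a i j = -1`. -/
def TiInvFormula (a : I → I → ℤ) (i : I) (T : Kt a → Kt a) : Prop :=
  ∀ (j : I) (m : ℤ),
    T (y a j m) =
      if a i j = -1 then
        (tq - tq⁻¹)⁻¹ • (tHalf • (y a i m * y a j m) - tHalf⁻¹ • (y a j m * y a i m))
      else y a j (m - if i = j then 1 else 0)

section Abstract

variable {K R : Type*} [Field K] [Ring R] [Algebra K R]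

/-- `x` and `y` commute up to the scalar `α`. -/
def QC (α : K) (x y : R) : Prop := x * y = α • (y * x)

/-- The unnormalized root vector. -/
def wv (t : K) (a x : R) : R := t • (a * x) - x * a

theorem QC.wv_left {t α β : K} {a x b : R} (h1 : QC α a b) (h2 : QC β x b) :
    QC (α * β) (wv t a x) b := by
  unfold QC wv at *
  have h1' : ∀ r, a * (b * r) = α • (b * (a * r)) := fun r => by
    rw [← mul_assoc, h1, smul_mul_assoc, mul_assoc]
  have h2' : ∀ r, x * (b * r) = β • (b * (x * r)) := fun r => by
    rw [← mul_assoc, h2, smul_mul_assoc, mul_assoc]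
  simp only [mul_sub, sub_mul, smul_mul_assoc, mul_smul_comm, mul_assoc, smul_sub, smul_smul,
    h1, h2, h1', h2']
  match_scalars <;> ring

theorem QC.wv_right {t α β : K} {a x b : R} (h1 : QC α b a) (h2 : QC β b x) :
    QC (α * β) b (wv t a x) := by
  unfold QC wv at *
  have h1' : ∀ r, b * (a * r) = α • (a * (b * r)) := fun r => by
    rw [← mul_assoc, h1, smul_mul_assoc, mul_assoc]
  have h2' : ∀ r, b * (x * r) = β • (x * (b * r)) := fun r => by
    rw [← mul_assoc, h2, smul_mul_assoc, mul_assoc]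
  simp only [mul_sub, sub_mul, smul_mul_assoc, mul_smul_comm, mul_assoc, smul_sub, smul_smul,
    h1, h2, h1', h2']
  match_scalars <;> ring

theorem QC.smul_left {α : K} {x y : R} (h : QC α x y) (c : K) : QC α (c • x) y := by
  unfold QC at *
  rw [smul_mul_assoc, h, mul_smul_comm, smul_comm]

theorem QC.smul_right {α : K} {x y : R} (h : QC α x y) (c : K) : QC α x (c • y) := by
  unfold QC at *
  rw [smul_mul_assoc, mul_smul_comm, h, smul_comm]

theorem wv_comm {t : K} (ht : t ≠ 0) (h2 : t ^ 2 + 1 ≠ 0) {x a b : R} (hab : a * b = b * a)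
    (ha : x ^ 2 * a + a * x ^ 2 = (t + t⁻¹) • (x * a * x))
    (hb : x ^ 2 * b + b * x ^ 2 = (t + t⁻¹) • (x * b * x)) :
    wv t a x * wv t b x = wv t b x * wv t a x := by
  unfold wv
  have e1 := congrArg (fun r => (t ^ 2 * (t + t⁻¹)⁻¹) • (a * r)) hb
  have e2 := congrArg (fun r => ((t + t⁻¹)⁻¹) • (r * b)) ha
  have e3 := congrArg (fun r => (t ^ 2 * (t + t⁻¹)⁻¹) • (b * r)) ha
  have e4 := congrArg (fun r => ((t + t⁻¹)⁻¹) • (r * a)) hb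
  have hab' : ∀ r, a * (b * r) = b * (a * r) := fun r => by
    rw [← mul_assoc, hab, mul_assoc]
  have h3 : (t + t⁻¹) ≠ 0 := by
    intro h
    apply h2
    field_simp at h
    linear_combination h
  simp only [pow_two, mul_add, add_mul, mul_sub, sub_mul, smul_mul_assoc, mul_smul_comm,
    mul_assoc, smul_sub, smul_add, smul_smul, hab, hab'] at e1 e2 e3 e4 ⊢
  linear_combination (norm := skip) e3 - e1 - e2 + e4
  match_scalars <;> field_simp <;> ring

/-- `A u = t u A + κ a`. -/
theorem wv_mul_u {t : K} (ht : t ≠ 0) {x a u : R} (hau : QC t⁻¹ a u)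
    (hxu : x * u = t ^ 2 • (u * x) + (1 - t ^ 2) • 1) :
    wv t a x * u = t • (u * wv t a x) + ((1 - t ^ 2) * (t - t⁻¹)) • a := by
  unfold QC wv at *
  have h1' : ∀ r, a * (u * r) = t⁻¹ • (u * (a * r)) := fun r => by
    rw [← mul_assoc, hau, smul_mul_assoc, mul_assoc]
  have h2' : ∀ r, x * (u * r) = t ^ 2 • (u * (x * r)) + (1 - t ^ 2) • r := fun r => by
    rw [← mul_assoc, hxu, add_mul, smul_mul_assoc, mul_assoc, smul_mul_assoc, one_mul]
  simp only [mul_add, mul_sub, sub_mul, smul_mul_assoc, mul_smul_comm, mul_assoc, smul_sub,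
    smul_add, smul_smul, hau, hxu, h1', h2', mul_one]
  match_scalars <;> field_simp <;> ring

theorem wv_mul_a {t : K} (ht : t ≠ 0) {x a : R}
    (h : a ^ 2 * x + x * a ^ 2 = (t + t⁻¹) • (a * x * a)) :
    QC t⁻¹ (wv t a x) a := by
  unfold QC wv
  simp only [pow_two, mul_assoc, mul_sub, sub_mul, smul_mul_assoc, mul_smul_comm,
    smul_sub, smul_smul] at h ⊢
  linear_combination (norm := skip) -h
  match_scalars <;> field_simp <;> ring

theorem wv_mul_x {t : K} (ht : t ≠ 0) {x a : R}
    (h : x ^ 2 * a + a * x ^ 2 = (t + t⁻¹) • (x * a * x)) :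
    QC t (wv t a x) x := by
  unfold QC wv
  simp only [pow_two, mul_assoc, mul_sub, sub_mul, smul_mul_assoc, mul_smul_comm,
    smul_sub, smul_smul] at h ⊢
  linear_combination (norm := skip) t • h
  match_scalars <;> field_simp <;> ring

theorem x_mul_wv {t : K} (ht : t ≠ 0) {x a : R}
    (h : x ^ 2 * a + a * x ^ 2 = (t + t⁻¹) • (x * a * x)) :
    QC t⁻¹ x (wv t a x) := by
  have := wv_mul_x ht h
  unfold QC at *
  rw [this, smul_smul, inv_mul_cancel₀ ht, one_smul]

/-- Serre relation with `u` squared. -/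
theorem serre_u {t κ : K} (ht : t ≠ 0) {A a u : R} (hau : QC t⁻¹ a u)
    (hA : A * u = t • (u * A) + κ • a) :
    u ^ 2 * A + A * u ^ 2 = (t + t⁻¹) • (u * A * u) := by
  unfold QC at *
  have h1' : ∀ r, A * (u * r) = t • (u * (A * r)) + κ • (a * r) := fun r => by
    rw [← mul_assoc, hA, add_mul, smul_mul_assoc, mul_assoc, smul_mul_assoc]
  simp only [pow_two, mul_assoc, mul_add, smul_mul_assoc, mul_smul_comm,
    smul_add, smul_smul, hA, h1', hau]
  match_scalars <;> field_simp <;> ring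

theorem serre_A {t κ : K} (ht : t ≠ 0) {A a u : R} (hAa : QC t⁻¹ A a)
    (hA : A * u = t • (u * A) + κ • a) :
    A ^ 2 * u + u * A ^ 2 = (t + t⁻¹) • (A * u * A) := by
  unfold QC at *
  have h1' : ∀ r, A * (u * r) = t • (u * (A * r)) + κ • (a * r) := fun r => by
    rw [← mul_assoc, hA, add_mul, smul_mul_assoc, mul_assoc, smul_mul_assoc]
  simp only [pow_two, mul_assoc, mul_add, add_mul, smul_mul_assoc, mul_smul_comm,
    smul_add, smul_smul, hA, h1', hAa]
  match_scalars <;> field_simp <;> ring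

theorem serre_Ab {t : K} (ht : t ≠ 0) (h2 : t ^ 2 + 1 ≠ 0) {x a b : R} (hbx : b * x = x * b)
    (hx : x ^ 2 * a + a * x ^ 2 = (t + t⁻¹) • (x * a * x))
    (hab : a ^ 2 * b + b * a ^ 2 = (t + t⁻¹) • (a * b * a)) :
    wv t a x ^ 2 * b + b * wv t a x ^ 2 = (t + t⁻¹) • (wv t a x * b * wv t a x) := by
  have hAx := wv_mul_x ht hx
  unfold QC at hAx
  obtain ⟨A, hA⟩ : ∃ A, A = wv t a x := ⟨_, rfl⟩
  rw [← hA] at hAx ⊢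
  have hax : a * x = t⁻¹ • A + t⁻¹ • (x * a) := by
    rw [hA, wv]
    match_scalars <;> field_simp <;> ring
  have hax' : ∀ r, a * (x * r) = t⁻¹ • (A * r) + t⁻¹ • (x * (a * r)) := fun r => by
    rw [← mul_assoc, hax, add_mul, smul_mul_assoc, smul_mul_assoc, mul_assoc]
  have hAx' : ∀ r, A * (x * r) = t • (x * (A * r)) := fun r => by
    rw [← mul_assoc, hAx, smul_mul_assoc, mul_assoc]
  have hbx' : ∀ r, b * (x * r) = x * (b * r) := fun r => by
    rw [← mul_assoc, hbx, mul_assoc]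
  have h3 : (t + t⁻¹) ≠ 0 := by
    intro h
    apply h2
    field_simp at h
    linear_combination h
  have hQ : t • (a * A * b) + A * a * b + t • (b * a * A) + b * A * a
      = (t + t⁻¹) • (t • (a * b * A) + A * b * a) := by
    have e1 := congrArg (fun r => t ^ 2 • (r * x)) hab
    have e2 := congrArg (fun r => x * r) hab
    simp only [pow_two, mul_add, add_mul, smul_mul_assoc, mul_smul_comm,
      mul_assoc, smul_add, smul_smul, hax, hax', hAx, hAx', hbx, hbx'] at e1 e2 ⊢
    linear_combination (norm := skip) e1 - e2
    match_scalars <;> field_simp <;> ring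
  have e1 := congrArg (fun r => (t + t⁻¹)⁻¹ • (r * x)) hQ
  have e2 := congrArg (fun r => (t + t⁻¹)⁻¹ • (x * r)) hQ
  simp only [pow_two, mul_add, add_mul, smul_mul_assoc, mul_smul_comm,
    mul_assoc, smul_add, smul_smul, hax, hax', hAx, hAx', hbx, hbx'] at e1 e2 ⊢
  linear_combination (norm := skip) e1 - e2
  match_scalars <;> field_simp <;> ring

theorem serre_bA {t q : K} {x a b : R} (hbx : b * x = x * b)
    (hab : b ^ 2 * a + a * b ^ 2 = q • (b * a * b)) :
    b ^ 2 * wv t a x + wv t a x * b ^ 2 = q • (b * wv t a x * b) := by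
  unfold wv
  have hbx' : ∀ r, b * (x * r) = x * (b * r) := fun r => by
    rw [← mul_assoc, hbx, mul_assoc]
  have e1 := congrArg (fun r => t • (r * x)) hab
  have e2 := congrArg (fun r => x * r) hab
  simp only [pow_two, mul_add, add_mul, mul_sub, sub_mul, smul_mul_assoc, mul_smul_comm,
      mul_assoc, smul_add, smul_sub, smul_smul, hbx, hbx'] at e1 e2 ⊢
  linear_combination (norm := skip) e1 - e2
  match_scalars <;> ring

theorem boson_AB {t e d : K} (ht : t ≠ 0) {x a u b : R} (hau : QC t⁻¹ a u) (hxb : QC t⁻¹ x b)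
    (hxu : x * u = t ^ 2 • (u * x) + (1 - t ^ 2) • 1)
    (hab : a * b = e • (b * a) + d • 1) :
    wv t a x * wv t b u = e • (wv t b u * wv t a x)
      + (-((1 - t ^ 2) * (t - t⁻¹) * d)) • 1 := by
  have hAu := wv_mul_u ht hau hxu
  have hAb : wv t a x * b = (e * t⁻¹) • (b * wv t a x) := by
    unfold QC at hxb
    unfold wv
    have h1' : ∀ r, a * (b * r) = e • (b * (a * r)) + d • r := fun r => by
      rw [← mul_assoc, hab, add_mul, smul_mul_assoc, mul_assoc, smul_mul_assoc, one_mul]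
    have h2' : ∀ r, x * (b * r) = t⁻¹ • (b * (x * r)) := fun r => by
      rw [← mul_assoc, hxb, smul_mul_assoc, mul_assoc]
    simp only [mul_add, mul_sub, sub_mul, smul_mul_assoc, mul_smul_comm, mul_assoc, smul_sub,
      smul_add, smul_smul, hab, hxb, h1', h2', mul_one]
    match_scalars <;> field_simp <;> ring
  obtain ⟨A, hA⟩ : ∃ A, A = wv t a x := ⟨_, rfl⟩
  rw [← hA] at hAu hAb ⊢
  unfold wv
  have h1' : ∀ r, A * (b * r) = (e * t⁻¹) • (b * (A * r)) := fun r => by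
    rw [← mul_assoc, hAb, smul_mul_assoc, mul_assoc]
  have h2' : ∀ r, A * (u * r) = t • (u * (A * r)) + ((1 - t ^ 2) * (t - t⁻¹)) • (a * r) :=
    fun r => by
      rw [← mul_assoc, hAu, add_mul, smul_mul_assoc, mul_assoc, smul_mul_assoc]
  simp only [mul_add, mul_sub, sub_mul, smul_mul_assoc, mul_smul_comm, mul_assoc, smul_sub,
      smul_add, smul_smul, hAb, hAu, h1', h2', hab]
  match_scalars <;> field_simp <;> ring

/-- `u B = t⁻¹ ...`: the inhomogeneous terms cancel when `x` meets `wv t b u`. -/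
theorem x_mul_B {t : K} (ht : t ≠ 0) {x u b : R} (hxb : QC t⁻¹ x b)
    (hxu : x * u = t ^ 2 • (u * x) + (1 - t ^ 2) • 1) :
    QC t x (wv t b u) := by
  unfold QC wv at *
  have h1' : ∀ r, x * (b * r) = t⁻¹ • (b * (x * r)) := fun r => by
    rw [← mul_assoc, hxb, smul_mul_assoc, mul_assoc]
  have h2' : ∀ r, x * (u * r) = t ^ 2 • (u * (x * r)) + (1 - t ^ 2) • r := fun r => by
    rw [← mul_assoc, hxu, add_mul, smul_mul_assoc, mul_assoc, smul_mul_assoc, one_mul]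
  simp only [mul_add, mul_sub, sub_mul, smul_mul_assoc, mul_smul_comm, mul_assoc, smul_sub,
    smul_add, smul_smul, hxb, hxu, h1', h2', mul_one]
  match_scalars <;> field_simp <;> ring

theorem serre_smul {q c : K} {x a : R} (h : x ^ 2 * a + a * x ^ 2 = q • (x * a * x)) :
    (c • x) ^ 2 * a + a * (c • x) ^ 2 = q • ((c • x) * a * (c • x)) := by
  have e := congrArg (fun r => c ^ 2 • r) h
  simp only [pow_two, smul_mul_assoc, mul_smul_comm, smul_add, smul_smul] at e ⊢
  linear_combination (norm := skip) e
  match_scalars <;> ring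

theorem serre_smul' {q c : K} {x a : R} (h : x ^ 2 * a + a * x ^ 2 = q • (x * a * x)) :
    x ^ 2 * (c • a) + (c • a) * x ^ 2 = q • (x * (c • a) * x) := by
  have e := congrArg (fun r => c • r) h
  simp only [pow_two, smul_mul_assoc, mul_smul_comm, smul_add, smul_smul] at e ⊢
  linear_combination (norm := skip) e
  match_scalars <;> ring

theorem QC.congr {α β : K} {x y : R} (h : QC α x y) (e : α = β) : QC β x y := e ▸ h

end Abstract

section Concrete

variable {a : I → I → ℤ}

theorem tHalf_ne : tHalf ≠ 0 := RatFunc.X_ne_zero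

theorem tq_eq : tq = tHalf ^ 2 := rfl

theorem tq_ne : tq ≠ 0 := pow_ne_zero 2 tHalf_ne

theorem X_pow_four_ne (c : ℂ) : (RatFunc.X : F) ^ 4 ≠ RatFunc.C c := by
  intro h
  have h' : algebraMap (Polynomial ℂ) (RatFunc ℂ) (Polynomial.X ^ 4)
      = algebraMap (Polynomial ℂ) (RatFunc ℂ) (Polynomial.C c) := by
    rw [map_pow, RatFunc.algebraMap_X, RatFunc.algebraMap_C, h]
  have h'' := RatFunc.algebraMap_injective ℂ h'
  have := congrArg Polynomial.natDegree h''
  simp at this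

theorem tq_sq_add : tq ^ 2 + 1 ≠ 0 := by
  intro h
  apply X_pow_four_ne (-1)
  rw [map_neg, map_one]
  unfold tq at h
  linear_combination h

theorem tq_sub : tq - tq⁻¹ ≠ 0 := by
  intro h
  apply X_pow_four_ne 1
  rw [map_one]
  have h1 : tq ^ 2 = 1 := by
    have := tq_ne
    field_simp at h
    linear_combination h
  unfold tq at h1
  linear_combination h1

theorem y_comm0 {j k : I} (m : ℤ) (h : a j k = 0) :
    y a j m * y a k m = y a k m * y a j m := by
  have := RingQuot.mkAlgHom_rel F (KtRel.comm0 (a := a) (m := m) h)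
  simp only [map_mul] at this
  exact this

theorem y_serre {j k : I} (m : ℤ) (h : a j k = -1) :
    y a j m ^ 2 * y a k m + y a k m * y a j m ^ 2
      = (tq + tq⁻¹) • (y a j m * y a k m * y a j m) := by
  have := RingQuot.mkAlgHom_rel F (KtRel.serre (a := a) (m := m) h)
  simp only [map_mul, map_add, map_pow, map_smul] at this
  exact this

theorem y_boson (j k : I) (m : ℤ) :
    y a j m * y a k (m + 1) = tq ^ (a j k) • (y a k (m + 1) * y a j m)
      + (if j = k then (1 : F) - tq ^ 2 else 0) • (1 : Kt a) := by
  have := RingQuot.mkAlgHom_rel F (KtRel.boson (a := a) j k m)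
  split_ifs at this ⊢
  · simp only [map_mul, map_add, map_smul, map_one] at this
    exact this
  · simp only [map_mul, map_add, map_smul, map_zero] at this
    rw [zero_smul]
    exact this

theorem y_boson_ne {j k : I} (m : ℤ) (h : j ≠ k) :
    QC (tq ^ (a j k)) (y a j m) (y a k (m + 1)) := by
  have := y_boson (a := a) j k m
  rwa [if_neg h, zero_smul, add_zero] at this

theorem y_boson_eq (hA : IsCartanADE a) (j : I) (m : ℤ) :
    y a j m * y a j (m + 1) = tq ^ 2 • (y a j (m + 1) * y a j m)
      + (1 - tq ^ 2) • (1 : Kt a) := by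
  have := y_boson (a := a) j j m
  rw [if_pos rfl, hA.1 j] at this
  exact_mod_cast this

/-- The sign `(-1)^n` as an integer. -/
def sg (n : ℤ) : ℤ := (((-1 : ℤˣ) ^ n : ℤˣ) : ℤ)

theorem sg_succ (n : ℤ) : sg (n + 1) = - sg n := by
  unfold sg
  rw [zpow_add_one]
  simp

theorem sg_two : sg 2 = 1 := by decide

theorem sg_three : sg 3 = -1 := by decide

theorem y_tcomm (j k : I) {m p : ℤ} (h : p > m + 1) :
    QC (tq ^ (sg (p - m + 1) * a j k)) (y a j m) (y a k p) := by
  have := RingQuot.mkAlgHom_rel F (KtRel.tcomm (a := a) (i := j) (j := k) h)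
  simp only [map_mul, map_smul] at this
  exact this

theorem z_eq (i j : I) (m : ℤ) :
    z a i j m = ((tq - tq⁻¹)⁻¹ * tHalf⁻¹) • wv tq (y a j m) (y a i m) := by
  have := tHalf_ne
  unfold z wv
  rw [mul_smul]
  congr 1
  rw [tq_eq, smul_sub, smul_smul]
  congr 2
  field_simp

/-- The images of the generators. -/
def fT (a : I → I → ℤ) (i j : I) (m : ℤ) : Kt a :=
  if a i j = -1 then z a i j m else y a j (m + if i = j then 1 else 0)

theorem fT_self (hA : IsCartanADE a) (i : I) (m : ℤ) : fT a i i m = y a i (m + 1) := by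
  simp [fT, hA.1 i]

theorem fT_zero {i j : I} (hij : i ≠ j) (h : a i j = 0) (m : ℤ) : fT a i j m = y a j m := by
  simp [fT, h, hij]

theorem fT_one {i j : I} (h : a i j = -1) (m : ℤ) :
    fT a i j m = ((tq - tq⁻¹)⁻¹ * tHalf⁻¹) • wv tq (y a j m) (y a i m) := by
  simp [fT, h, z_eq]

theorem tri (hA : IsCartanADE a) (i j : I) :
    i = j ∨ (i ≠ j ∧ a i j = 0) ∨ (i ≠ j ∧ a i j = -1) := by
  by_cases h : i = j
  · exact Or.inl h
  · rcases hA.2.2.1 i j h with h' | h'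
    · exact Or.inr (Or.inl ⟨h, h'⟩)
    · exact Or.inr (Or.inr ⟨h, h'⟩)

theorem no_triangle (hA : IsCartanADE a) {i j k : I} (h1 : a i j = -1) (h2 : a i k = -1)
    (h3 : a j k = -1) : False := by
  obtain ⟨hd, hs, -, hp⟩ := hA
  have hij : i ≠ j := by rintro rfl; have := hd i; omega
  have hik : i ≠ k := by rintro rfl; have := hd i; omega
  have hjk : j ≠ k := by rintro rfl; have := hd j; omega
  let v : I → ℝ := Pi.single i 1 + Pi.single j 1 + Pi.single k 1
  have hv : v ≠ 0 := by
    intro h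
    have := congrFun h i
    simp [v, hij, hik] at this
  have := hp.dotProduct_mulVec_pos hv
  have h1' := hs i j
  have h2' := hs i k
  have h3' := hs j k
  rw [h1] at h1'
  rw [h2] at h2'
  rw [h3] at h3'
  simp [v, Matrix.mulVec_add, add_dotProduct, h1, h2, h3, ← h1', ← h2', ← h3', hd] at this
  norm_num at this

theorem QC_one {R : Type*} [Ring R] [Algebra F R] {x y : R} : QC (1 : F) x y ↔ x * y = y * x := by
  unfold QC
  rw [one_smul]

theorem fT_comm0 (hA : IsCartanADE a) (i : I) {j k : I} (m : ℤ) (h : a j k = 0) :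
    fT a i j m * fT a i k m = fT a i k m * fT a i j m := by
  have h' : a k j = 0 := by rw [hA.2.1 k j, h]
  have hjk : j ≠ k := by rintro rfl; have := hA.1 j; omega
  rcases tri hA i j with rfl | ⟨hj, hj'⟩ | ⟨hj, hj'⟩
  · rw [fT_self hA, fT_zero hjk h]
    have := y_boson_ne (a := a) m hjk.symm
    rw [h', zpow_zero, QC_one] at this
    exact this.symm
  · rcases tri hA i k with rfl | ⟨hk, hk'⟩ | ⟨hk, hk'⟩
    · rw [fT_self hA, fT_zero hj hj']
      have := y_boson_ne (a := a) m hjk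
      rwa [h, zpow_zero, QC_one] at this
    · rw [fT_zero hk hk', fT_zero hj hj']
      exact y_comm0 m h
    · rw [fT_one hk', fT_zero hj hj', ← QC_one]
      refine QC.smul_right ?_ _
      exact (QC.wv_right (QC_one.2 (y_comm0 m h)) (QC_one.2 (y_comm0 m hj').symm)).congr (one_mul 1)
  · rcases tri hA i k with rfl | ⟨hk, hk'⟩ | ⟨hk, hk'⟩
    · omega
    · rw [fT_one hj', fT_zero hk hk', ← QC_one]
      refine QC.smul_left ?_ _
      exact (QC.wv_left (QC_one.2 (y_comm0 m h)) (QC_one.2 (y_comm0 m hk'))).congr (one_mul 1)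
    · rw [fT_one hk', fT_one hj', ← QC_one]
      refine QC.smul_left (QC.smul_right ?_ _) _
      rw [QC_one]
      exact wv_comm tq_ne tq_sq_add (y_comm0 m h) (y_serre m hj') (y_serre m hk')

theorem y_boson_neg {j k : I} (m : ℤ) (h : j ≠ k) (h' : a j k = -1) :
    QC tq⁻¹ (y a j m) (y a k (m + 1)) := by
  have := y_boson_ne (a := a) m h
  rwa [h', zpow_neg_one] at this

theorem fT_serre (hA : IsCartanADE a) (i : I) {j k : I} (m : ℤ) (h : a j k = -1) :
    fT a i j m ^ 2 * fT a i k m + fT a i k m * fT a i j m ^ 2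
      = (tq + tq⁻¹) • (fT a i j m * fT a i k m * fT a i j m) := by
  have h' : a k j = -1 := by rw [hA.2.1 k j, h]
  have hjk : j ≠ k := by rintro rfl; have := hA.1 j; omega
  rcases tri hA i j with rfl | ⟨hj, hj'⟩ | ⟨hj, hj'⟩
  · rw [fT_self hA, fT_one h]
    refine serre_smul' (serre_u tq_ne (y_boson_neg m hjk.symm h')
      (wv_mul_u tq_ne (y_boson_neg m hjk.symm h') (y_boson_eq hA _ m)))
  · rcases tri hA i k with rfl | ⟨hk, hk'⟩ | ⟨hk, hk'⟩
    · omega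
    · rw [fT_zero hk hk', fT_zero hj hj']
      exact y_serre m h
    · rw [fT_one hk', fT_zero hj hj']
      exact serre_smul' (serre_bA (y_comm0 m hj').symm (y_serre m h))
  · rcases tri hA i k with rfl | ⟨hk, hk'⟩ | ⟨hk, hk'⟩
    · rw [fT_self hA, fT_one hj']
      exact serre_smul (serre_A tq_ne (wv_mul_a tq_ne (y_serre m h))
        (wv_mul_u tq_ne (y_boson_neg m hjk h) (y_boson_eq hA _ m)))
    · rw [fT_one hj', fT_zero hk hk']
      exact serre_smul (serre_Ab tq_ne tq_sq_add (y_comm0 m hk').symm (y_serre m hj')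
        (y_serre m h))
    · exact (no_triangle hA hj' hk' h).elim

theorem fT_boson_ne (hA : IsCartanADE a) (i : I) {j k : I} (m : ℤ) (hjk : j ≠ k) :
    QC (tq ^ (a j k)) (fT a i j m) (fT a i k (m + 1)) := by
  have hs := hA.2.1
  rcases tri hA i j with rfl | ⟨hj, hj'⟩ | ⟨hj, hj'⟩
  · rcases tri hA i k with rfl | ⟨hk, hk'⟩ | ⟨hk, hk'⟩
    · exact (hjk rfl).elim
    · rw [fT_self hA, fT_zero hk hk', hk', zpow_zero, QC_one]
      exact y_comm0 _ hk'
    · rw [fT_self hA, fT_one hk', hk', zpow_neg_one]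
      exact (x_mul_wv tq_ne (y_serre _ hk')).smul_right _
  · rcases tri hA i k with rfl | ⟨hk, hk'⟩ | ⟨hk, hk'⟩
    · rw [fT_self hA, fT_zero hj hj']
      refine (y_tcomm j i (by omega)).congr ?_
      rw [hs j i, hj', mul_zero]
    · rw [fT_zero hj hj', fT_zero hk hk']
      exact y_boson_ne m hjk
    · rw [fT_zero hj hj', fT_one hk']
      refine ((QC.wv_right (y_boson_ne m hjk) (y_boson_ne m hj.symm)).smul_right _).congr ?_
      rw [hs j i, hj', zpow_zero, mul_one]
  · rcases tri hA i k with rfl | ⟨hk, hk'⟩ | ⟨hk, hk'⟩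
    · rw [fT_self hA, fT_one hj']
      refine ((QC.wv_left (y_tcomm j i (by omega)) (y_tcomm i i (by omega))).smul_left _).congr ?_
      rw [show m + 1 + 1 - m + 1 = 3 by ring, sg_three, hs j i, hj', hA.1 i, ← zpow_add₀ tq_ne]
      norm_num
    · rw [fT_zero hk hk', fT_one hj']
      refine ((QC.wv_left (y_boson_ne m hjk) (y_boson_ne m hk)).smul_left _).congr ?_
      rw [hk', zpow_zero, mul_one]
    · rw [fT_one hk', fT_one hj']
      refine (QC.smul_right ?_ _).smul_left _
      have := boson_AB (d := 0) (e := tq ^ (a j k)) tq_ne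
        (y_boson_neg m hj.symm ((hs j i).trans hj')) (y_boson_neg m hk hk')
        (y_boson_eq hA i m)
        (by rw [zero_smul, add_zero]; exact y_boson_ne (a := a) m hjk)
      rwa [mul_zero, neg_zero, zero_smul, add_zero] at this

theorem fT_boson_eq (hA : IsCartanADE a) (i j : I) (m : ℤ) :
    fT a i j m * fT a i j (m + 1) = tq ^ 2 • (fT a i j (m + 1) * fT a i j m)
      + (1 - tq ^ 2) • (1 : Kt a) := by
  have hs := hA.2.1
  rcases tri hA i j with rfl | ⟨hj, hj'⟩ | ⟨hj, hj'⟩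
  · rw [fT_self hA, fT_self hA]
    exact y_boson_eq hA _ _
  · rw [fT_zero hj hj', fT_zero hj hj']
    exact y_boson_eq hA _ _
  · rw [fT_one hj', fT_one hj']
    have := boson_AB tq_ne
        (y_boson_neg m hj.symm ((hs j i).trans hj')) (y_boson_neg m hj hj')
        (y_boson_eq hA i m) (y_boson_eq hA j m)
    simp only [smul_mul_assoc, mul_smul_comm, this, smul_add, smul_smul]
    congr 1
    · congr 1
      ring
    · congr 1
      have h1 := tHalf_ne
      have h2 := tq_sub
      have h3 := tq_ne
      have h4 : tq ^ 2 - 1 ≠ 0 := by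
        intro h
        apply h2
        field_simp
        linear_combination h
      rw [show (tq - tq⁻¹)⁻¹ = tq * (tq ^ 2 - 1)⁻¹ by field_simp,
        show tq - tq⁻¹ = (tq ^ 2 - 1) * tq⁻¹ by field_simp]
      field_simp
      rw [tq_eq]
      ring

theorem fT_tcomm (hA : IsCartanADE a) (i j k : I) {m p : ℤ} (h : p > m + 1) :
    QC (tq ^ (sg (p - m + 1) * a j k)) (fT a i j m) (fT a i k p) := by
  have hs := hA.2.1
  rcases tri hA i j with rfl | ⟨hj, hj'⟩ | ⟨hj, hj'⟩
  · rcases tri hA i k with rfl | ⟨hk, hk'⟩ | ⟨hk, hk'⟩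
    · rw [fT_self hA, fT_self hA]
      refine (y_tcomm i i (by omega)).congr ?_
      congr 3
      ring
    · rw [fT_self hA, fT_zero hk hk', hk', mul_zero]
      by_cases hp : p = m + 1 + 1
      · subst hp
        refine (y_boson_ne _ hk).congr ?_
        rw [hk']
      · refine (y_tcomm i k (by omega)).congr ?_
        rw [hk', mul_zero]
    · rw [fT_self hA, fT_one hk', hk']
      refine QC.smul_right ?_ _
      by_cases hp : p = m + 1 + 1
      · subst hp
        rw [show m + 1 + 1 - m + 1 = 3 by ring, sg_three]
        refine (x_mul_B tq_ne (y_boson_neg _ hk hk') (y_boson_eq hA _ _)).congr ?_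
        norm_num
      · refine (QC.wv_right (y_tcomm i k (by omega)) (y_tcomm i i (by omega))).congr ?_
        rw [← zpow_add₀ tq_ne, hk', hA.1 i, show p - m + 1 = p - (m + 1) + 1 + 1 by ring,
          sg_succ (p - (m + 1) + 1)]
        congr 1
        ring
  · rcases tri hA i k with rfl | ⟨hk, hk'⟩ | ⟨hk, hk'⟩
    · rw [fT_self hA, fT_zero hj hj']
      refine (y_tcomm j i (by omega)).congr ?_
      rw [hs j i, hj', mul_zero, mul_zero]
    · rw [fT_zero hj hj', fT_zero hk hk']
      exact y_tcomm j k h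
    · rw [fT_zero hj hj', fT_one hk']
      refine ((QC.wv_right (y_tcomm j k h) (y_tcomm j i h)).smul_right _).congr ?_
      rw [hs j i, hj', mul_zero, zpow_zero, mul_one]
  · rcases tri hA i k with rfl | ⟨hk, hk'⟩ | ⟨hk, hk'⟩
    · rw [fT_self hA, fT_one hj']
      refine ((QC.wv_left (y_tcomm j i (by omega)) (y_tcomm i i (by omega))).smul_left _).congr ?_
      rw [← zpow_add₀ tq_ne, hs j i, hj', hA.1 i, show p + 1 - m + 1 = p - m + 1 + 1 by ring,
          sg_succ]
      congr 1
      ring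
    · rw [fT_zero hk hk', fT_one hj']
      refine ((QC.wv_left (y_tcomm j k h) (y_tcomm i k h)).smul_left _).congr ?_
      rw [hk', mul_zero, zpow_zero, mul_one]
    · rw [fT_one hk', fT_one hj']
      refine (QC.smul_right ((QC.wv_left (QC.wv_right (y_tcomm j k h) (y_tcomm j i h))
        (QC.wv_right (y_tcomm i k h) (y_tcomm i i h))).congr ?_) _).smul_left _
      rw [← zpow_add₀ tq_ne, ← zpow_add₀ tq_ne, ← zpow_add₀ tq_ne, hs j i, hj', hk', hA.1 i]
      congr 1
      ring

/-- The lift to the free algebra. -/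
def fTfree (a : I → I → ℤ) (i : I) : FreeAlgebra F (I × ℤ) →ₐ[F] Kt a :=
  FreeAlgebra.lift F fun p => fT a i p.1 p.2

theorem fTfree_X (i j : I) (m : ℤ) : fTfree a i (X j m) = fT a i j m := by
  simp [fTfree, X]

theorem fTfree_rel (hA : IsCartanADE a) (i : I) ⦃p q : FreeAlgebra F (I × ℤ)⦄
    (h : KtRel a p q) : fTfree a i p = fTfree a i q := by
  cases h with
  | comm0 h =>
    simp only [map_mul, fTfree_X]
    exact fT_comm0 hA i _ h
  | serre h =>
    simp only [map_mul, map_add, map_pow, map_smul, fTfree_X]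
    exact fT_serre hA i _ h
  | boson j k m =>
    by_cases hjk : j = k
    · subst hjk
      rw [if_pos rfl, hA.1 j]
      simp only [map_mul, map_add, map_smul, map_one, fTfree_X]
      exact_mod_cast fT_boson_eq hA i j m
    · rw [if_neg hjk]
      simp only [map_mul, map_add, map_smul, map_zero, add_zero, fTfree_X]
      exact fT_boson_ne hA i m hjk
  | tcomm h =>
    simp only [map_mul, map_smul, fTfree_X]
    exact fT_tcomm hA i _ _ h

end Concrete

/-- For each `i ∈ I` there exists a unique `F`-algebra endomorphism `T_i` of
`K_t(A)` with `T_i(y(j,m)) = y(j, m + δ_{ij})` if `a i j ≠ -1` and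
`T_i(y(j,m)) = (t^{1/2} y(j,m) y(i,m) − t^{−1/2} y(i,m) y(j,m)) / (t − t^{−1})`
if `a i j = -1`. -/
theorem statement0 {I : Type} [Fintype I] [DecidableEq I] (a : I → I → ℤ)
    (hA : IsCartanADE a) (i : I) :
    ∃! T : Kt a →ₐ[F] Kt a, TiFormula a i ⇑T := by
  refine ⟨RingQuot.liftAlgHom F ⟨fTfree a i, fTfree_rel hA i⟩, ?_, ?_⟩
  · intro j m
    show RingQuot.liftAlgHom F _ (y a j m) = fT a i j m
    rw [y, RingQuot.liftAlgHom_mkAlgHom_apply, fTfree_X]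
  · intro T hT
    refine RingQuot.ringQuot_ext' F _ _ ?_
    refine FreeAlgebra.hom_ext ?_
    funext p
    obtain ⟨j, m⟩ := p
    have h1 : T (y a j m) = fT a i j m := hT j m
    show T (y a j m) = RingQuot.liftAlgHom F _ (y a j m)
    rw [h1, y, RingQuot.liftAlgHom_mkAlgHom_apply, fTfree_X]
end
end

section
/- Let i, j, k ∈ I with a(i,j) = −1, a(i,k) = 0 and a(j,k) = −1, and let m ∈ ℤ. Then in K_t(A) the elements z(i; j,m) and y(k,m) satisfy both quantum Serre relations: y(k,m)^2 z(i; j,m) − (t + t^{−1}) y(k,m) z(i; j,m) y(k,m) + z(i; j,m) y(k,m)^2 = 0 and z(i; j,m)^2 y(k,m) − (t + t^{−1}) z(i; j,m) y(k,m) z(i; j,m) + y(k,m) z(i; j,m)^2 = 0. -/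
noncomputable section

variable {I : Type} [Fintype I] [DecidableEq I]

/-- Generic computation: the second Serre relation. -/
theorem serre_aux {K R : Type*} [Field K] [Ring R] [Algebra K R] (s : K) (hs : s ≠ 0)
    (hs4 : s ^ 4 + 1 ≠ 0) (a b c : R) (hac : c * a = a * c)
    (hab : a ^ 2 * b + b * a ^ 2 = (s ^ 2 + (s ^ 2)⁻¹) • (a * b * a))
    (hbc : b ^ 2 * c + c * b ^ 2 = (s ^ 2 + (s ^ 2)⁻¹) • (b * c * b)) :
    (s • (b * a) - s⁻¹ • (a * b)) ^ 2 * c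
      - (s ^ 2 + (s ^ 2)⁻¹) • ((s • (b * a) - s⁻¹ • (a * b)) * c *
          (s • (b * a) - s⁻¹ • (a * b)))
      + c * (s • (b * a) - s⁻¹ • (a * b)) ^ 2 = 0 := by
  have hac' : ∀ x : R, c * (a * x) = a * (c * x) := fun x => by
    rw [← mul_assoc, hac, mul_assoc]
  have r1 := congrArg (fun x : R => x * (b * c)) hab
  have r2 := congrArg (fun x : R => b * x * c) hab
  have r3 := congrArg (fun x : R => b * c * x) hab
  have r4 := congrArg (fun x : R => x * (c * b)) hab
  have r5 := congrArg (fun x : R => c * x * b) hab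
  have r6 := congrArg (fun x : R => c * b * x) hab
  have r7 := congrArg (fun x : R => x * (a * a)) hbc
  have r8 := congrArg (fun x : R => a * x * a) hbc
  have r9 := congrArg (fun x : R => a * a * x) hbc
  simp only [pow_two a, pow_two b, mul_add, add_mul, mul_assoc, smul_mul_assoc,
    mul_smul_comm, hac, hac'] at r1 r2 r3 r4 r5 r6 r7 r8 r9
  simp only [pow_two (_ - _), mul_sub, sub_mul, mul_assoc, smul_mul_assoc,
    mul_smul_comm, hac, hac']
  linear_combination (norm := skip) (-(s ^ 4 + 1)⁻¹) • r1 - (s ^ 4 * (s ^ 4 + 1)⁻¹) • r2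
    + (s ^ 2) • r3 + (s ^ 2)⁻¹ • r4 - (s ^ 4 + 1)⁻¹ • r5 - (s ^ 4 * (s ^ 4 + 1)⁻¹) • r6
    + (s ^ 4 * (s ^ 4 + 1)⁻¹) • r7 - r8 + (s ^ 4 + 1)⁻¹ • r9
  match_scalars <;> field_simp <;> ring

/-- Generic computation: the first Serre relation. -/
theorem serre_aux1 {K R : Type*} [Field K] [Ring R] [Algebra K R] (s q : K)
    (a b c : R) (hac : c * a = a * c)
    (hcb : c ^ 2 * b + b * c ^ 2 = q • (c * b * c)) :
    c ^ 2 * (s • (b * a) - s⁻¹ • (a * b))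
      - q • (c * (s • (b * a) - s⁻¹ • (a * b)) * c)
      + (s • (b * a) - s⁻¹ • (a * b)) * c ^ 2 = 0 := by
  have hac' : ∀ x : R, c * (a * x) = a * (c * x) := fun x => by
    rw [← mul_assoc, hac, mul_assoc]
  have r1 := congrArg (fun x : R => x * a) hcb
  have r2 := congrArg (fun x : R => a * x) hcb
  simp only [pow_two c, mul_add, add_mul, mul_assoc, smul_mul_assoc,
    mul_smul_comm, hac, hac'] at r1 r2
  simp only [pow_two c, mul_sub, sub_mul, mul_assoc, smul_mul_assoc,
    mul_smul_comm, hac, hac']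
  linear_combination (norm := module) s • r1 - s⁻¹ • r2

/-- Both relations are homogeneous in `Z`. -/
theorem scale_aux {K R : Type*} [Field K] [Ring R] [Algebra K R] (d q : K) (Z c : R)
    (e1 : c ^ 2 * Z - q • (c * Z * c) + Z * c ^ 2 = 0)
    (e2 : Z ^ 2 * c - q • (Z * c * Z) + c * Z ^ 2 = 0) :
    (c ^ 2 * (d • Z) - q • (c * (d • Z) * c) + (d • Z) * c ^ 2 = 0) ∧
    ((d • Z) ^ 2 * c - q • ((d • Z) * c * (d • Z)) + c * (d • Z) ^ 2 = 0) := by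
  constructor
  · simp only [mul_smul_comm, smul_mul_assoc]
    linear_combination (norm := module) d • e1
  · simp only [pow_two, mul_smul_comm, smul_mul_assoc] at e2 ⊢
    linear_combination (norm := module) (d * d) • e2

theorem X4_ne : (tHalf ^ 4 + 1 : F) ≠ 0 := by
  have h : (Polynomial.X ^ 4 + 1 : Polynomial ℂ) ≠ 0 := by
    intro h
    have := congrArg (Polynomial.eval 0) h
    simp at this
  intro h'
  apply h
  apply RatFunc.algebraMap_injective ℂ
  simpa [tHalf] using h'

/-- for `a i j = -1`, `a i k = 0`, `a j k = -1`, the elements `z(i;j,m)`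
and `y(k,m)` satisfy both quantum Serre relations. -/
theorem statement12 {I : Type} [Fintype I] [DecidableEq I] (a : I → I → ℤ)
    (hA : IsCartanADE a) (i j k : I) (hij : a i j = -1) (hik : a i k = 0)
    (hjk : a j k = -1) (m : ℤ) :
    (y a k m ^ 2 * z a i j m
        - (tq + tq⁻¹) • (y a k m * z a i j m * y a k m)
        + z a i j m * y a k m ^ 2 = 0) ∧
    (z a i j m ^ 2 * y a k m
        - (tq + tq⁻¹) • (z a i j m * y a k m * z a i j m)
        + y a k m * z a i j m ^ 2 = 0) := by
  have hsym := hA.2.1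
  have hc : y a k m * y a i m = y a i m * y a k m := by
    have := RingQuot.mkAlgHom_rel F (KtRel.comm0 (a := a) (m := m) ((hsym k i).trans hik))
    simpa [y] using this
  have hS : ∀ p r : I, a p r = -1 → y a p m ^ 2 * y a r m + y a r m * y a p m ^ 2
      = (tHalf ^ 2 + (tHalf ^ 2)⁻¹) • (y a p m * y a r m * y a p m) := by
    intro p r h
    have := RingQuot.mkAlgHom_rel F (KtRel.serre (a := a) (m := m) h)
    have ht : tq = tHalf ^ 2 := rfl
    simpa only [y, map_add, map_mul, map_pow, map_smul, ht] using this
  have hs : tHalf ≠ 0 := RatFunc.X_ne_zero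
  have e1 := serre_aux1 tHalf _ _ _ _ hc (hS k j ((hsym k j).trans hjk))
  have e2 := serre_aux tHalf hs X4_ne _ _ _ hc (hS i j hij) (hS j k hjk)
  have ht : tq = tHalf ^ 2 := rfl
  rw [z, ht]
  generalize (tHalf ^ 2 - (tHalf ^ 2)⁻¹)⁻¹ = d
  generalize tHalf • (y a j m * y a i m) - tHalf⁻¹ • (y a i m * y a j m) = Z at e1 e2 ⊢
  generalize (tHalf ^ 2 + (tHalf ^ 2)⁻¹) = q at e1 e2 ⊢
  exact scale_aux d q Z _ e1 e2
end
end
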